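/- Let d ≥ 2, let i be a nonnegative integer and let Ω_i be a measurable function on S^{d−1} with ‖Ω_i‖_{L^∞(S^{d−1})} ≤ 2^i. Let j ∈ ℤ, x₀ ∈ ℝ^d, B = B(x₀, 10d·2^j), and let y ∈ ℝ^d with |y − x₀| ≤ √d·2^j. Then the function x ↦ Ω_i((x−y)/|x−y|) satisfies ‖Ω_i((·−y)/|·−y|)‖_{L log L, B} ≤ C_d (2^{−i} + (1+i)‖Ω_i‖_{L¹(S^{d−1})}), where C_d depends only on d. -/

import Mathlib

open MeasureTheory Metric Set Filter
open scoped ENNReal NNReal Real Topology Pointwise FourierTransform RealInnerProductSpace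

noncomputable section

/-- Euclidean space `ℝ^d`. -/
abbrev Rd (d : ℕ) := EuclideanSpace ℝ (Fin d)

/-- Surface measure on the unit sphere `S^{d-1}`, realized as the `(d-1)`-dimensional
Hausdorff measure restricted to the sphere. -/
def sphereMeasure (d : ℕ) : Measure (Rd d) := (μH[(d : ℝ) - 1]).restrict (sphere (0 : Rd d) 1)

/-- `Φ(t) = t log(e + t)`. -/
def Phi (t : ℝ) : ℝ := t * Real.log (Real.exp 1 + t)

/-- `Q` is an (axis-parallel, closed) cube with side length `l`. -/
def IsCubeSide {d : ℕ} (Q : Set (Rd d)) (l : ℝ) : Prop :=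
  ∃ c : Rd d, Q = {x | ∀ i, x i ∈ Icc (c i) (c i + l)}

/-- `Q` is a (nondegenerate) cube. -/
def IsCube {d : ℕ} (Q : Set (Rd d)) : Prop := ∃ l : ℝ, 0 < l ∧ IsCubeSide Q l

/-- `Q` is a standard dyadic cube `2^k([0,1]^d + m)`. -/
def IsDyadicCube {d : ℕ} (Q : Set (Rd d)) : Prop :=
  ∃ (k : ℤ) (m : Fin d → ℤ),
    Q = {x | ∀ i, x i ∈ Icc ((2:ℝ)^k * m i) ((2:ℝ)^k * (m i + 1))}

/-- mean value `⟨b⟩_Q` of `b` on `Q`. -/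
def cavg {d : ℕ} (b : Rd d → ℝ) (Q : Set (Rd d)) : ℝ := ⨍ x in Q, b x

/-- `b` is in `BMO(ℝ^d)` with `‖b‖_{BMO} ≤ M`. -/
def BMOBound {d : ℕ} (b : Rd d → ℝ) (M : ℝ) : Prop :=
  MeasureTheory.LocallyIntegrable b volume ∧
    ∀ Q : Set (Rd d), IsCube Q → (⨍ x in Q, |b x - cavg b Q|) ≤ M

/-- `Ω` is homogeneous of degree zero. -/
def Homog0 {d : ℕ} (Ω : Rd d → ℝ) : Prop := ∀ r : ℝ, 0 < r → ∀ x : Rd d, Ω (r • x) = Ω x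

/-- The Luxemburg norm `‖f‖_{L^p(log L)^α, Q}`
(`∞`, i.e. `⊤`, if no admissible constant exists). -/
def LuxNorm {d : ℕ} (p α : ℝ) (Q : Set (Rd d)) (f : Rd d → ℝ) : ℝ≥0∞ :=
  sInf {c : ℝ≥0∞ | ∃ t : ℝ, 0 < t ∧ c = ENNReal.ofReal t ∧
    ∫⁻ x in Q,
      ENNReal.ofReal ((|f x| / t) ^ p * (Real.log (Real.exp 1 + |f x| / t)) ^ α) ≤ volume Q}

/-- convolution `K * g`. -/
def convK {d : ℕ} (K g : Rd d → ℝ) (x : Rd d) : ℝ := ∫ y, K (x - y) * g y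

lemma norm_inv_smul_self_le {E : Type*} [NormedAddCommGroup E] [NormedSpace ℝ E] (x : E) :
    ‖‖x‖⁻¹ • x‖ ≤ 1 := by
  rw [norm_smul, norm_inv, norm_norm]
  exact inv_mul_le_one

lemma norm_smul_norm_inv_smul_self {E : Type*} [NormedAddCommGroup E] [NormedSpace ℝ E] (x : E) :
    ‖x‖ • ‖x‖⁻¹ • x = x := by
  rcases eq_or_ne x 0 with rfl | hx
  · simp
  · rw [smul_smul, mul_inv_cancel₀ (norm_ne_zero_iff.2 hx), one_smul]

lemma lipschitzOnWith_norm_inv_smul {E : Type*} [NormedAddCommGroup E] [NormedSpace ℝ E] :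
    LipschitzOnWith 2 (fun x : E => ‖x‖⁻¹ • x) {x | 1 ≤ ‖x‖} := by
  refine LipschitzOnWith.of_dist_le_mul fun x hx y hy => ?_
  simp only [mem_ofPred_eq] at hx hy
  have hx0 : 0 < ‖x‖ := by linarith
  have hy0 : 0 < ‖y‖ := by linarith
  have h : ‖x‖⁻¹ • x - ‖y‖⁻¹ • y = ‖x‖⁻¹ • ((x - y) + (‖y‖ - ‖x‖) • ‖y‖⁻¹ • y) := by
    rw [sub_smul, norm_smul_norm_inv_smul_self, sub_add_sub_cancel, smul_sub, smul_smul,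
      inv_mul_cancel₀ hx0.ne', one_smul]
  rw [dist_eq_norm, dist_eq_norm, h, norm_smul, norm_inv, norm_norm]
  calc ‖x‖⁻¹ * ‖(x - y) + (‖y‖ - ‖x‖) • ‖y‖⁻¹ • y‖
      ≤ 1 * (‖x - y‖ + ‖x - y‖ * 1) := by
        gcongr
        · exact inv_le_one_of_one_le₀ hx
        · refine (norm_add_le _ _).trans ?_
          gcongr
          rw [norm_smul]
          gcongr
          · rw [← norm_neg (x - y), neg_sub]; exact abs_norm_sub_norm_le y x
          · exact norm_inv_smul_self_le y
    _ = _ := by simp; ring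

/-- The unit sphere is covered by the radial projections of the faces of the cube
`[-1, 1]^(m + 1)`. -/
lemma sphere_subset_iUnion_image_insertNth (m : ℕ) :
    sphere (0 : Rd (m + 1)) 1 ⊆ ⋃ k : Fin (m + 1), ⋃ s ∈ ({1, -1} : Finset ℝ),
      (fun x : Rd (m + 1) => ‖x‖⁻¹ • x) ''
        ((fun z : Fin m → ℝ => WithLp.toLp 2 (k.insertNth (α := fun _ => ℝ) s z)) ''
          closedBall 0 1) := by
  intro x hx
  have hx1 : ‖x‖ = 1 := by simpa using hx
  obtain ⟨k, hk⟩ := Finite.exists_max fun l => |x l|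
  have hk0 : 0 < |x k| := by
    by_contra! h
    have : x = 0 := by
      ext l
      exact abs_nonpos_iff.1 ((hk l).trans h)
    simp [this] at hx1
  simp only [mem_iUnion]
  have hface : ∀ s : ℝ, x k = s * |x k| → x ∈ (fun x : Rd (m + 1) => ‖x‖⁻¹ • x) ''
      ((fun z : Fin m → ℝ => WithLp.toLp 2 (k.insertNth (α := fun _ => ℝ) s z)) ''
          closedBall 0 1) := by
    intro s hs
    have hsx : WithLp.toLp 2 (k.insertNth (α := fun _ => ℝ) s
        fun l => |x k|⁻¹ * x (k.succAbove l)) = |x k|⁻¹ • x := by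
      ext l
      refine Fin.succAboveCases k ?_ (fun l => ?_) l
      · simp only [Fin.insertNth_apply_same, PiLp.smul_apply, smul_eq_mul]
        rw [eq_inv_mul_iff_mul_eq₀ hk0.ne', mul_comm, ← hs]
      · simp
    refine ⟨_, ⟨_, ?_, hsx⟩, ?_⟩
    · rw [mem_closedBall_zero_iff, pi_norm_le_iff_of_nonneg zero_le_one]
      intro l
      rw [norm_mul, norm_inv, Real.norm_eq_abs, Real.norm_eq_abs, abs_abs, inv_mul_le_one₀ hk0]
      exact hk _
    · simp only [norm_smul, norm_inv, Real.norm_eq_abs, abs_abs, hx1, mul_one, inv_inv, smul_smul]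
      rw [mul_inv_cancel₀ hk0.ne', one_smul]
  rcases le_or_gt 0 (x k) with h | h
  · exact ⟨k, 1, by simp, hface 1 (by rw [abs_of_nonneg h, one_mul])⟩
  · exact ⟨k, -1, by simp, hface (-1) (by rw [abs_of_neg h]; ring)⟩

lemma sphereMeasure_univ_lt_top (m : ℕ) : sphereMeasure (m + 1) univ < ∞ := by
  rw [sphereMeasure, Measure.restrict_apply_univ]
  have hm : ((m + 1 : ℕ) : ℝ) - 1 = m := by push_cast; ring
  rw [hm]
  refine (measure_mono (sphere_subset_iUnion_image_insertNth m)).trans_lt ?_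
  refine (measure_iUnion_fintype_le _ _).trans_lt (ENNReal.sum_lt_top.2 fun k _ => ?_)
  refine (measure_biUnion_finset_le _ _).trans_lt (ENNReal.sum_lt_top.2 fun s hs => ?_)
  have hins : LipschitzWith 1 (fun z : Fin m → ℝ => k.insertNth (α := fun _ => ℝ) s z) := by
    refine LipschitzWith.of_dist_le_mul fun z w => ?_
    rw [Fin.dist_insertNth_insertNth]
    simp
  have hface := (PiLp.lipschitzWith_toLp 2 fun _ : Fin (m + 1) => ℝ).comp hins
  refine ((lipschitzOnWith_norm_inv_smul.mono ?_).hausdorffMeasure_image_le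
    (Nat.cast_nonneg m)).trans_lt (ENNReal.mul_lt_top (by finiteness) ?_)
  · rintro _ ⟨z, -, rfl⟩
    have h1 : |s| = 1 := by
      simp only [Finset.mem_insert, Finset.mem_singleton] at hs
      rcases hs with rfl | rfl <;> simp
    have := PiLp.norm_apply_le (p := 2)
      (WithLp.toLp 2 (k.insertNth (α := fun _ => ℝ) s z) : Rd (m + 1)) k
    simpa [h1] using this
  · refine (hface.hausdorffMeasure_image_le (Nat.cast_nonneg m) _).trans_lt
      (ENNReal.mul_lt_top (by finiteness) ?_)
    have := hausdorffMeasure_pi_real (ι := Fin m)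
    rw [Fintype.card_fin] at this
    rw [this]
    exact measure_closedBall_lt_top

/-- A sector of a ball of radius `R` over a set of directions of diameter at most `1 / N` is
covered by `N` balls of radius `2 R / N`. -/
lemma volume_sector_le {d : ℕ} (y : Rd d) {R : ℝ} (hR : 0 < R) {N : ℕ} (hN : 0 < N) {s : Set (Rd d)}
    (hs : ediam s ≤ ENNReal.ofReal (N : ℝ)⁻¹) :
    volume ((fun x => ‖x - y‖⁻¹ • (x - y)) ⁻¹' s ∩ ball y R) ≤
      N * (ENNReal.ofReal ((2 * R / N) ^ d) * volume (ball (0 : Rd d) 1)) := by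
  have hN' : (0 : ℝ) < N := by exact_mod_cast hN
  rcases ((fun x => ‖x - y‖⁻¹ • (x - y)) ⁻¹' s ∩ ball y R).eq_empty_or_nonempty with h | ⟨z, hz, -⟩
  · simp [h]
  set u := ‖z - y‖⁻¹ • (z - y) with hu
  have hu1 : ‖u‖ ≤ 1 := norm_inv_smul_self_le _
  have hcover : (fun x => ‖x - y‖⁻¹ • (x - y)) ⁻¹' s ∩ ball y R ⊆
      ⋃ k ∈ Finset.range N, closedBall (y + (k * (R / N)) • u) (2 * R / N) := by
    rintro x ⟨hx, hxR⟩
    rw [mem_ball, dist_eq_norm] at hxR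
    have hdist : ‖‖x - y‖⁻¹ • (x - y) - u‖ ≤ (N : ℝ)⁻¹ := by
      rw [← dist_eq_norm, ← ENNReal.ofReal_le_ofReal_iff (by positivity), ← edist_dist]
      exact (edist_le_ediam_of_mem (mem_preimage.1 hx) (mem_preimage.1 hz)).trans hs
    set a := ‖x - y‖ / (R / N) with ha
    have ha0 : 0 ≤ a := by positivity
    have hxa : ‖x - y‖ = a * (R / N) := by rw [ha]; field_simp
    have hk : ⌊a⌋₊ < N := by
      rw [Nat.floor_lt ha0, ha, div_lt_iff₀ (by positivity)]
      field_simp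
      exact hxR
    simp only [mem_iUnion, Finset.mem_range]
    refine ⟨⌊a⌋₊, hk, ?_⟩
    rw [mem_closedBall, dist_eq_norm]
    have hsplit : x - (y + (⌊a⌋₊ * (R / N)) • u) =
        ‖x - y‖ • (‖x - y‖⁻¹ • (x - y) - u) + ((a - ⌊a⌋₊) * (R / N)) • u := by
      rw [smul_sub, norm_smul_norm_inv_smul_self, sub_mul, sub_smul, ← hxa]
      abel
    have hfl : |a - ⌊a⌋₊| ≤ 1 := by
      rw [abs_le]
      constructor <;> linarith [Nat.floor_le ha0, Nat.lt_floor_add_one a]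
    calc ‖x - (y + (⌊a⌋₊ * (R / N)) • u)‖
        ≤ R * (N : ℝ)⁻¹ + 1 * (R / N) * 1 := by
          rw [hsplit]
          refine (norm_add_le _ _).trans ?_
          rw [norm_smul, norm_smul, norm_norm, norm_mul, Real.norm_eq_abs, Real.norm_eq_abs,
            abs_of_pos (show 0 < R / N by positivity)]
          gcongr
      _ = 2 * R / N := by ring
  refine (measure_mono hcover).trans ((measure_biUnion_finset_le _ _).trans ?_)
  refine (Finset.sum_le_card_nsmul _ _ _ fun k _ => ?_).trans_eq
    (by rw [Finset.card_range, nsmul_eq_mul])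
  rw [Measure.addHaar_closedBall _ _ (by positivity), finrank_euclideanSpace_fin]

lemma volume_sector_le_ediam_pow {m : ℕ} (y : Rd (m + 1)) {R : ℝ} (hR : 0 < R)
    {s : Set (Rd (m + 1))} (hs : ediam s ≤ 1) :
    volume ((fun x => ‖x - y‖⁻¹ • (x - y)) ⁻¹' s ∩ ball y R) ≤
      ENNReal.ofReal ((4 * R) ^ (m + 1)) * volume (ball (0 : Rd (m + 1)) 1) * ediam s ^ m := by
  have hsmall : ∀ r : ℝ, 0 < r → r ≤ 1 → ediam s ≤ ENNReal.ofReal r →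
      volume ((fun x => ‖x - y‖⁻¹ • (x - y)) ⁻¹' s ∩ ball y R) ≤
        ENNReal.ofReal ((4 * R) ^ (m + 1)) * volume (ball (0 : Rd (m + 1)) 1) *
          ENNReal.ofReal r ^ m := by
    intro r hr hr1 hsr
    have h1 : 1 ≤ r⁻¹ := (one_le_inv₀ hr).2 hr1
    have hN : 0 < ⌊r⁻¹⌋₊ := Nat.floor_pos.2 h1
    have hN' : (1 : ℝ) ≤ ⌊r⁻¹⌋₊ := by exact_mod_cast hN
    have hrN : r ≤ (⌊r⁻¹⌋₊ : ℝ)⁻¹ := by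
      rw [le_inv_comm₀ hr (by positivity)]
      exact Nat.floor_le (by positivity)
    have hNr : (⌊r⁻¹⌋₊ : ℝ)⁻¹ ≤ 2 * r := by
      have h2 : r⁻¹ ≤ 2 * ⌊r⁻¹⌋₊ := by linarith [Nat.lt_floor_add_one r⁻¹]
      rw [inv_le_iff_one_le_mul₀ hr] at h2
      rw [inv_le_iff_one_le_mul₀ (by positivity)]
      linarith
    refine (volume_sector_le y hR hN (hsr.trans (ENNReal.ofReal_le_ofReal hrN))).trans ?_
    rw [← mul_assoc, mul_right_comm _ (volume _), ← ENNReal.ofReal_natCast,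
      ← ENNReal.ofReal_mul (by positivity), ← ENNReal.ofReal_pow hr.le,
      ← ENNReal.ofReal_mul (by positivity)]
    gcongr ENNReal.ofReal ?_ * _
    generalize (⌊r⁻¹⌋₊ : ℝ) = n at *
    have hn : 0 < n := by linarith
    calc n * (2 * R / n) ^ (m + 1) = (2 * R) ^ (m + 1) * n⁻¹ ^ m := by
          rw [div_eq_mul_inv, mul_pow, pow_succ n⁻¹ m]
          field_simp
      _ ≤ (2 * R) ^ (m + 1) * (2 * r) ^ m := by gcongr
      _ ≤ (2 * R) ^ (m + 1) * (2 ^ (m + 1) * r ^ m) := by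
          rw [mul_pow 2 r]
          gcongr
          · norm_num
          · omega
      _ = (4 * R) ^ (m + 1) * r ^ m := by
          rw [← mul_assoc, ← mul_pow]
          ring_nf
  have hfin : ediam s ≠ ∞ := (hs.trans_lt ENNReal.one_lt_top).ne
  rcases eq_or_ne (ediam s) 0 with h0 | h0
  · have hlim : Tendsto (fun r : ℝ => ENNReal.ofReal ((4 * R) ^ (m + 1)) *
        volume (ball (0 : Rd (m + 1)) 1) * ENNReal.ofReal r ^ m) (𝓝[>] 0)
        (𝓝 (ENNReal.ofReal ((4 * R) ^ (m + 1)) * volume (ball (0 : Rd (m + 1)) 1) *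
          ENNReal.ofReal 0 ^ m)) := by
      refine ENNReal.Tendsto.const_mul ?_ (Or.inr ?_)
      · exact ((ENNReal.continuous_pow m).comp ENNReal.continuous_ofReal).continuousAt.tendsto.mono_left
          nhdsWithin_le_nhds
      · exact ENNReal.mul_ne_top ENNReal.ofReal_ne_top measure_ball_lt_top.ne
    rw [h0, ← ENNReal.ofReal_zero]
    refine ge_of_tendsto hlim ?_
    filter_upwards [Ioo_mem_nhdsGT zero_lt_one] with r hr
    exact hsmall r hr.1 hr.2.le (by simp [h0])
  · have := hsmall (ediam s).toReal (ENNReal.toReal_pos h0 hfin)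
      (ENNReal.toReal_le_of_le_ofReal zero_le_one (by simpa using hs))
      (by rw [ENNReal.ofReal_toReal hfin])
    rwa [ENNReal.ofReal_toReal hfin] at this

lemma measurable_norm_inv_smul_sub {d : ℕ} (y : Rd d) :
    Measurable fun x : Rd d => ‖x - y‖⁻¹ • (x - y) := by
  fun_prop

/-- The angular distribution of Lebesgue measure on a ball around `y` is controlled by the surface
measure. -/
lemma map_volume_ball_le_sphereMeasure {m : ℕ} (y : Rd (m + 1)) {R : ℝ} (hR : 0 < R) :
    (volume.restrict (ball y R)).map (fun x => ‖x - y‖⁻¹ • (x - y)) ≤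
      (ENNReal.ofReal ((4 * R) ^ (m + 1)) * volume (ball (0 : Rd (m + 1)) 1)) •
        sphereMeasure (m + 1) := by
  set c := ENNReal.ofReal ((4 * R) ^ (m + 1)) * volume (ball (0 : Rd (m + 1)) 1)
  set ν := (volume.restrict (ball y R)).map (fun x => ‖x - y‖⁻¹ • (x - y))
  have hc0 : c ≠ 0 := mul_ne_zero (by simpa using by positivity)
    (measure_ball_pos _ _ one_pos).ne'
  have hct : c ≠ ∞ := ENNReal.mul_ne_top ENNReal.ofReal_ne_top measure_ball_lt_top.ne
  have hP := measurable_norm_inv_smul_sub y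
  have hH : c⁻¹ • ν ≤ μH[((m + 1 : ℕ) : ℝ) - 1] := by
    refine Measure.le_hausdorffMeasure _ _ 1 one_pos fun s hs => ?_
    rw [show ((m + 1 : ℕ) : ℝ) - 1 = m by push_cast; ring, ENNReal.rpow_natCast,
      Measure.smul_apply, smul_eq_mul, ENNReal.inv_mul_le_iff hc0 hct]
    rw [← ediam_closure] at hs ⊢
    refine (measure_mono subset_closure).trans ?_
    rw [Measure.map_apply hP isClosed_closure.measurableSet,
      Measure.restrict_apply (hP isClosed_closure.measurableSet)]
    exact volume_sector_le_ediam_pow y hR hs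
  have hν : ν = ν.restrict (sphere 0 1) := by
    refine (Measure.restrict_eq_self_of_ae_mem ?_).symm
    refine (ae_map_iff hP.aemeasurable isClosed_sphere.measurableSet).2 ?_
    refine ae_restrict_of_ae ?_
    filter_upwards [Measure.ae_ne volume y] with x hx
    rw [dist_zero_right, norm_smul, norm_inv, norm_norm,
      inv_mul_cancel₀ (norm_ne_zero_iff.2 (sub_ne_zero.2 hx))]
  rw [hν]
  have hν' : ν.restrict (sphere 0 1) = c • (c⁻¹ • ν).restrict (sphere 0 1) := by
    rw [Measure.restrict_smul, smul_smul, ENNReal.mul_inv_cancel hc0 hct, one_smul]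
  rw [hν', sphereMeasure]
  gcongr

lemma log_exp_one_add_le {i : ℕ} {s : ℝ} (hs0 : 0 ≤ s) (hs : s ≤ 4 ^ i) :
    Real.log (Real.exp 1 + s) ≤ 2 * (1 + i) := by
  rw [Real.log_le_iff_le_exp (by positivity)]
  have he := Real.add_one_le_exp (1 : ℝ)
  have h4 : (4 : ℝ) ^ i ≤ Real.exp 2 ^ i := by
    gcongr
    rw [show (2 : ℝ) = 1 + 1 by norm_num, Real.exp_add]
    nlinarith
  have h1 : (1 : ℝ) ≤ Real.exp 2 ^ i := one_le_pow₀ (Real.one_le_exp (by norm_num))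
  calc Real.exp 1 + s ≤ Real.exp 1 * Real.exp 2 ^ i + Real.exp 2 ^ i := by nlinarith
    _ ≤ Real.exp 1 * Real.exp 1 * Real.exp 2 ^ i := by
      nlinarith [mul_nonneg (sub_nonneg.2 he) (Real.exp_pos 1).le,
        mul_nonneg (show 0 ≤ Real.exp 1 * Real.exp 1 - Real.exp 1 - 1 by nlinarith)
          (zero_le_one.trans h1)]
    _ = Real.exp (2 * (1 + i)) := by
      rw [← Real.exp_add, ← Real.exp_nat_mul, ← Real.exp_add]
      ring_nf

/-- An `L log L` Luxemburg-norm bound for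
`x ↦ Ω_i((x-y)/|x-y|)` over the ball `B(x₀, 10d·2^j)`. -/
theorem statement4 (d : ℕ) (hd : 2 ≤ d) :
    ∃ C : ℝ, 0 < C ∧
      ∀ (i : ℕ) (Ωi : Rd d → ℝ), Measurable Ωi → Homog0 Ωi →
        (∀ᵐ θ ∂(sphereMeasure d), |Ωi θ| ≤ 2 ^ i) →
        ∀ (j : ℤ) (x₀ y : Rd d), ‖y - x₀‖ ≤ Real.sqrt d * (2:ℝ) ^ j →
          LuxNorm 1 1 (ball x₀ (10 * d * (2:ℝ) ^ j))
              (fun x => Ωi (‖x - y‖⁻¹ • (x - y))) ≤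
            ENNReal.ofReal
              (C * ((2:ℝ) ^ (-(i:ℤ)) + (1 + (i:ℝ)) * ∫ θ, |Ωi θ| ∂(sphereMeasure d))) := by
  obtain ⟨m, rfl⟩ : ∃ m, d = m + 1 := ⟨d - 1, by omega⟩
  refine ⟨2 * 8 ^ (m + 1), by positivity, fun i Ω hΩ _ hbound j x₀ y hy => ?_⟩
  set R : ℝ := 10 * (m + 1 : ℕ) * (2 : ℝ) ^ j
  have hR : 0 < R := by positivity
  have : IsFiniteMeasure (sphereMeasure (m + 1)) := ⟨sphereMeasure_univ_lt_top m⟩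
  set L := ∫ θ, |Ω θ| ∂(sphereMeasure (m + 1))
  have hL0 : 0 ≤ L := integral_nonneg fun _ => abs_nonneg _
  set t : ℝ := 2 * 8 ^ (m + 1) * ((2 : ℝ) ^ (-(i : ℤ)) + (1 + (i : ℝ)) * L)
  have ht2 : (2 : ℝ) ^ (-(i : ℤ)) ≤ t := by
    have h8 : (1 : ℝ) ≤ 8 ^ (m + 1) := one_le_pow₀ (by norm_num)
    have hp : 0 < (2 : ℝ) ^ (-(i : ℤ)) := by positivity
    have hq : 0 ≤ (1 + (i : ℝ)) * L := by positivity
    nlinarith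
  have ht : 0 < t := lt_of_lt_of_le (by positivity) ht2
  have hint : ∫⁻ θ, ENNReal.ofReal |Ω θ| ∂(sphereMeasure (m + 1)) = ENNReal.ofReal L := by
    refine (ofReal_integral_eq_lintegral_ofReal ?_ (ae_of_all _ fun _ => abs_nonneg _)).symm
    refine Integrable.of_bound hΩ.abs.aestronglyMeasurable (2 ^ i) ?_
    simpa using hbound
  refine sInf_le ⟨t, ht, rfl, ?_⟩
  simp only [Real.rpow_one]
  set F : Rd (m + 1) → ℝ≥0∞ := fun θ =>
    ENNReal.ofReal (|Ω θ| / t * Real.log (Real.exp 1 + |Ω θ| / t))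
  have hF : Measurable F := by fun_prop
  have hsub : ball x₀ R ⊆ ball y (2 * R) := by
    refine ball_subset_ball' ?_
    rw [dist_comm, dist_eq_norm]
    have : Real.sqrt (m + 1 : ℕ) ≤ 10 * (m + 1 : ℕ) := by
      rw [Real.sqrt_le_left (by positivity)]
      have : (1 : ℝ) ≤ (m + 1 : ℕ) := by exact_mod_cast Nat.succ_pos m
      nlinarith
    have : Real.sqrt (m + 1 : ℕ) * (2 : ℝ) ^ j ≤ R :=
      mul_le_mul_of_nonneg_right this (by positivity)
    linarith
  have hFle : ∀ᵐ θ ∂(sphereMeasure (m + 1)),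
      F θ ≤ ENNReal.ofReal (2 * (1 + i) / t) * ENNReal.ofReal |Ω θ| := by
    filter_upwards [hbound] with θ hθ
    rw [← ENNReal.ofReal_mul (by positivity)]
    refine ENNReal.ofReal_le_ofReal ?_
    have hs : |Ω θ| / t ≤ 4 ^ i := by
      rw [div_le_iff₀ ht]
      calc |Ω θ| ≤ 2 ^ i := hθ
        _ = 4 ^ i * (2 : ℝ) ^ (-(i : ℤ)) := by
          rw [zpow_neg, zpow_natCast, show (4 : ℝ) = 2 * 2 by norm_num, mul_pow]
          field_simp
        _ ≤ 4 ^ i * t := by gcongr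
    calc |Ω θ| / t * Real.log (Real.exp 1 + |Ω θ| / t)
        ≤ |Ω θ| / t * (2 * (1 + i)) := by
          gcongr
          exact log_exp_one_add_le (by positivity) hs
      _ = _ := by ring
  calc ∫⁻ x in ball x₀ R, F (‖x - y‖⁻¹ • (x - y))
      ≤ ∫⁻ x in ball y (2 * R), F (‖x - y‖⁻¹ • (x - y)) := lintegral_mono_set hsub
    _ = ∫⁻ θ, F θ ∂(volume.restrict (ball y (2 * R))).map (fun x => ‖x - y‖⁻¹ • (x - y)) :=
        (lintegral_map hF (measurable_norm_inv_smul_sub y)).symm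
    _ ≤ (ENNReal.ofReal ((4 * (2 * R)) ^ (m + 1)) * volume (ball (0 : Rd (m + 1)) 1)) *
          ∫⁻ θ, F θ ∂(sphereMeasure (m + 1)) := by
        have := lintegral_mono' (f := F)
          (map_volume_ball_le_sphereMeasure y (show 0 < 2 * R by positivity)) le_rfl
        rwa [lintegral_smul_measure, smul_eq_mul] at this
    _ ≤ (ENNReal.ofReal ((4 * (2 * R)) ^ (m + 1)) * volume (ball (0 : Rd (m + 1)) 1)) *
          (ENNReal.ofReal (2 * (1 + i) / t) * ENNReal.ofReal L) := by
        gcongr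
        rw [← hint, ← lintegral_const_mul _ (by fun_prop)]
        exact lintegral_mono_ae hFle
    _ = ENNReal.ofReal ((4 * (2 * R)) ^ (m + 1) * (2 * (1 + i) / t * L)) *
          volume (ball (0 : Rd (m + 1)) 1) := by
        rw [mul_right_comm, ← ENNReal.ofReal_mul (by positivity),
          ← ENNReal.ofReal_mul (by positivity)]
    _ ≤ ENNReal.ofReal (R ^ (m + 1)) * volume (ball (0 : Rd (m + 1)) 1) := by
        gcongr
        rw [show 4 * (2 * R) = R * 8 by ring, mul_pow, mul_assoc]
        refine mul_le_of_le_one_right (by positivity) ?_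
        rw [div_mul_eq_mul_div, ← mul_div_assoc, div_le_one ht]
        have : 0 ≤ 2 * 8 ^ (m + 1) * (2 : ℝ) ^ (-(i : ℤ)) := by positivity
        calc (8 : ℝ) ^ (m + 1) * (2 * (1 + i) * L)
            ≤ 8 ^ (m + 1) * (2 * (1 + i) * L) + 2 * 8 ^ (m + 1) * (2 : ℝ) ^ (-(i : ℤ)) := by
              linarith
          _ = t := by ring
    _ = volume (ball x₀ R) := by
        rw [Measure.addHaar_ball _ _ hR.le, finrank_euclideanSpace_fin]
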